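/- arXiv:1510.01534 — 2 statements merged into one kernel-verified Lean document; each statement's English description precedes it below -/
import Mathlib

section
/- Let T be a closed densely defined linear operator from H₁ to H₂ with closed range, let T† be its Moore–Penrose inverse, and let S : H₁ → H₂ be a bounded linear operator satisfying ‖T† ∘ S‖ < 1, T(T†(Su)) = Su for all u ∈ H₁, and S(T†(Tx)) = Sx for all x ∈ D(T). Then the Moore–Penrose inverse (T+S)† of T + S is bounded and satisfies ‖(T + S)† − T†‖ ≤ ‖S‖ ‖T†‖² / (1 − ‖T† S‖). -/
/-- The null space `N(T)` of a partially defined operator `T`, as a submodule of the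
ambient space. -/
def pmKer {H₁ H₂ : Type*} [NormedAddCommGroup H₁] [InnerProductSpace ℂ H₁]
    [NormedAddCommGroup H₂] [InnerProductSpace ℂ H₂] (T : H₁ →ₗ.[ℂ] H₂) : Submodule ℂ H₁ :=
  (LinearMap.ker T.toFun).map T.domain.subtype

/-- The range `R(T)` of a partially defined operator `T`. -/
def pmRan {H₁ H₂ : Type*} [NormedAddCommGroup H₁] [InnerProductSpace ℂ H₁]
    [NormedAddCommGroup H₂] [InnerProductSpace ℂ H₂] (T : H₁ →ₗ.[ℂ] H₂) : Submodule ℂ H₂ :=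
  LinearMap.range T.toFun

/-- `Td` is the Moore–Penrose inverse of the closed range, densely defined operator `T`:
it is a bounded operator with range contained in the carrier `C(T) = D(T) ∩ N(T)^⊥`,
`T (T† y) = P_{R(T)} y` for all `y`, `T† (T x) = P_{N(T)^⊥} x` for all `x ∈ D(T)`,
and `N(T†) = R(T)^⊥` (the projection identities are expressed via the characteristic
orthogonality properties of orthogonal projections onto closed subspaces). -/
structure IsMPOf {H₁ H₂ : Type*} [NormedAddCommGroup H₁] [InnerProductSpace ℂ H₁]
    [NormedAddCommGroup H₂] [InnerProductSpace ℂ H₂]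
    (T : H₁ →ₗ.[ℂ] H₂) (Td : H₂ →L[ℂ] H₁) : Prop where
  mem_dom : ∀ y : H₂, Td y ∈ T.domain
  mem_carrier : ∀ y : H₂, Td y ∈ (pmKer T)ᗮ
  proj_ran : ∀ y : H₂, y - T ⟨Td y, mem_dom y⟩ ∈ (pmRan T)ᗮ
  proj_ker : ∀ x : T.domain, (x : H₁) - Td (T x) ∈ pmKer T
  ker_eq : ∀ y : H₂, Td y = 0 ↔ y ∈ (pmRan T)ᗮ

/-- The operator `T + S` with domain `D(T)`, where `T` is partially defined and
`S` is bounded. -/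
def addPM {H₁ H₂ : Type*} [NormedAddCommGroup H₁] [InnerProductSpace ℂ H₁]
    [NormedAddCommGroup H₂] [InnerProductSpace ℂ H₂]
    (T : H₁ →ₗ.[ℂ] H₂) (S : H₁ →L[ℂ] H₂) : H₁ →ₗ.[ℂ] H₂ :=
  ⟨T.domain, T.toFun + (S : H₁ →ₗ[ℂ] H₂).comp T.domain.subtype⟩

/-- Membership in the null space of a partially defined operator. -/
theorem mem_pmKer_iff {H₁ H₂ : Type*} [NormedAddCommGroup H₁] [InnerProductSpace ℂ H₁]
    [NormedAddCommGroup H₂] [InnerProductSpace ℂ H₂] (T : H₁ →ₗ.[ℂ] H₂) (x : H₁) :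
    x ∈ pmKer T ↔ ∃ h : x ∈ T.domain, T ⟨x, h⟩ = 0 := by
  constructor
  · rintro ⟨y, hy, rfl⟩
    exact ⟨y.2, hy⟩
  · rintro ⟨h, hx⟩
    exact ⟨⟨x, h⟩, hx, rfl⟩

/-- Membership in the range of a partially defined operator. -/
theorem mem_pmRan_iff {H₁ H₂ : Type*} [NormedAddCommGroup H₁] [InnerProductSpace ℂ H₁]
    [NormedAddCommGroup H₂] [InnerProductSpace ℂ H₂] (T : H₁ →ₗ.[ℂ] H₂) (y : H₂) :
    y ∈ pmRan T ↔ ∃ x : T.domain, T x = y :=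
  Iff.rfl

/-- If `‖K‖ < 1` then `1 + K` has a bounded two-sided inverse. -/
theorem exists_inverse_one_add_of_norm_lt_one {E : Type*} [NormedAddCommGroup E]
    [NormedSpace ℂ E] [CompleteSpace E] (K : E →L[ℂ] E) (hK : ‖K‖ < 1) :
    ∃ A : E →L[ℂ] E, (∀ x, A x + K (A x) = x) ∧ ∀ x, A (x + K x) = x := by
  let u := Units.oneSub (-K) (by rwa [norm_neg])
  have hu : (u : E →L[ℂ] E) = 1 + K := by simp [u]
  refine ⟨(u⁻¹ : (E →L[ℂ] E)ˣ), fun x ↦ ?_, fun x ↦ ?_⟩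
  · simpa [hu] using DFunLike.congr_fun u.mul_inv x
  · simpa [hu] using DFunLike.congr_fun u.inv_mul x

/-- If `T T† S = S` then `(T + S) x = T (x + T† S x)` on the domain of `T`. -/
theorem addPM_apply_eq {H₁ H₂ : Type*} [NormedAddCommGroup H₁] [InnerProductSpace ℂ H₁]
    [NormedAddCommGroup H₂] [InnerProductSpace ℂ H₂]
    (T : H₁ →ₗ.[ℂ] H₂) (Td : H₂ →L[ℂ] H₁) (S : H₁ →L[ℂ] H₂)
    (hdom : ∀ y, Td y ∈ T.domain) (hS : ∀ u, T ⟨Td (S u), hdom (S u)⟩ = S u)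
    (x : H₁) (hx : x ∈ T.domain) :
    addPM T S ⟨x, hx⟩ = T ⟨x + Td (S x), T.domain.add_mem hx (hdom _)⟩ := by
  have h := T.map_add ⟨x, hx⟩ ⟨Td (S x), hdom (S x)⟩
  rw [hS] at h
  exact h.symm

/-- Remark 3.7: under the hypotheses of Theorem 3.5, the Moore–Penrose inverse of
`T + S` is bounded and `‖(T + S)† − T†‖ ≤ ‖S‖ ‖T†‖² / (1 − ‖T† S‖)`. -/
theorem stmt6 {H₁ H₂ : Type*} [NormedAddCommGroup H₁] [InnerProductSpace ℂ H₁] [CompleteSpace H₁]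
    [NormedAddCommGroup H₂] [InnerProductSpace ℂ H₂] [CompleteSpace H₂]
    (T : H₁ →ₗ.[ℂ] H₂) (hTclosed : T.IsClosed) (hTdense : Dense (T.domain : Set H₁))
    (hTran : IsClosed (pmRan T : Set H₂))
    (Td : H₂ →L[ℂ] H₁) (hMP : IsMPOf T Td) (S : H₁ →L[ℂ] H₂)
    (hnorm : ‖Td.comp S‖ < 1)
    (hS1 : ∀ u : H₁, T ⟨Td (S u), hMP.mem_dom (S u)⟩ = S u)
    (hS2 : ∀ x : T.domain, S (Td (T x)) = S (x : H₁)) :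
    ∃ U : H₂ →L[ℂ] H₁, IsMPOf (addPM T S) U ∧
      ‖U - Td‖ ≤ ‖S‖ * ‖Td‖ ^ 2 / (1 - ‖Td.comp S‖) := by
  obtain ⟨A, hA, hA'⟩ := exists_inverse_one_add_of_norm_lt_one (Td.comp S) hnorm
  simp only [ContinuousLinearMap.comp_apply] at hA hA'
  have hadd := addPM_apply_eq T Td S hMP.mem_dom hS1
  have hAdom : ∀ y ∈ T.domain, A y ∈ T.domain := fun y hy ↦ by
    rw [eq_sub_of_add_eq (hA y)]
    exact T.domain.sub_mem hy (hMP.mem_dom _)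
  have hSker : ∀ n ∈ pmKer T, S n = 0 := fun n hn ↦ by
    obtain ⟨h, hn⟩ := (mem_pmKer_iff T n).1 hn
    simpa [hn] using (hS2 ⟨n, h⟩).symm
  have hker_of : ∀ w, w + Td (S w) ∈ pmKer T → w ∈ pmKer T := fun w hw ↦ by
    have h := hA' (w + Td (S w))
    rw [hSker _ hw, map_zero, add_zero, hA'] at h
    rwa [h]
  have hker : pmKer (addPM T S) = pmKer T := by
    ext x
    constructor
    · intro hx
      obtain ⟨h, hx⟩ := (mem_pmKer_iff _ x).1 hx
      rw [hadd x h] at hx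
      exact hker_of x ((mem_pmKer_iff _ _).2 ⟨_, hx⟩)
    · intro hx
      obtain ⟨h, hx'⟩ := (mem_pmKer_iff _ x).1 hx
      refine (mem_pmKer_iff _ x).2 ⟨h, ?_⟩
      rw [hadd x h]
      simpa [hSker x hx] using hx'
  have hran : pmRan (addPM T S) = pmRan T := by
    ext y
    rw [mem_pmRan_iff, mem_pmRan_iff]
    constructor
    · rintro ⟨⟨x, hx⟩, rfl⟩
      exact ⟨_, (hadd x hx).symm⟩
    · rintro ⟨⟨x, hx⟩, rfl⟩
      refine ⟨⟨A x, hAdom x hx⟩, ?_⟩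
      rw [hadd (A x) (hAdom x hx)]
      simp only [hA]
  refine ⟨A.comp Td, ⟨fun y ↦ hAdom _ (hMP.mem_dom y), fun y ↦ ?_, fun y ↦ ?_, fun x ↦ ?_,
    fun y ↦ ?_⟩, ?_⟩
  · rw [hker, ContinuousLinearMap.comp_apply, eq_sub_of_add_eq (hA (Td y))]
    exact Submodule.sub_mem _ (hMP.mem_carrier _) (hMP.mem_carrier _)
  · rw [hran]
    simp only [ContinuousLinearMap.comp_apply]
    rw [hadd (A (Td y)) (hAdom _ (hMP.mem_dom y))]
    simp only [hA]
    exact hMP.proj_ran y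
  · obtain ⟨x, hx⟩ := x
    rw [hker, hadd x hx]
    apply hker_of
    have h := hMP.proj_ker ⟨x + Td (S x), T.domain.add_mem hx (hMP.mem_dom _)⟩
    convert h using 1
    simp only [ContinuousLinearMap.comp_apply, map_sub]
    nth_rewrite 3 [← hA (Td (T ⟨x + Td (S x), T.domain.add_mem hx (hMP.mem_dom _)⟩))]
    abel
  · rw [hran, ← hMP.ker_eq, ContinuousLinearMap.comp_apply]
    refine ⟨fun h ↦ ?_, fun h ↦ by rw [h, map_zero]⟩
    simpa [h] using (hA (Td y)).symm
  · have hD : A.comp Td - Td = -((Td.comp S).comp Td) - (Td.comp S).comp (A.comp Td - Td) := by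
      ext y
      simp only [ContinuousLinearMap.comp_apply, sub_apply,
        neg_apply, map_sub]
      nth_rewrite 2 [← hA (Td y)]
      abel
    have h₁ : ‖A.comp Td - Td‖ ≤
        ‖(Td.comp S).comp Td‖ + ‖(Td.comp S).comp (A.comp Td - Td)‖ := by
      conv_lhs => rw [hD]
      simpa only [norm_neg] using
        norm_sub_le (-((Td.comp S).comp Td)) ((Td.comp S).comp (A.comp Td - Td))
    have h₂ := (Td.comp S).opNorm_comp_le (A.comp Td - Td)
    have h₃ := (Td.comp S).opNorm_comp_le Td
    have h₄ := mul_le_mul_of_nonneg_right (Td.opNorm_comp_le S) (norm_nonneg Td)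
    rw [le_div_iff₀ (by linarith)]
    nlinarith
end

section
/- Let T be a closed densely defined linear operator from H₁ to H₂ with closed range, with adjoint T*. Then the closed operators T*T and TT* have closed range, their Moore–Penrose inverses (T*T)† and (TT*)† are bounded, and: (i) for every y ∈ H₂, (TT*)†y lies in D(T*) and T*((TT*)†y) = T†y; (ii) for every z ∈ D(T*), (T*T)†(T*z) = T†z. -/
/-- The composition `S ∘ T` of partially defined operators, with domain
`{x ∈ D(T) : T x ∈ D(S)}`. -/
noncomputable def compPM {H₁ H₂ H₃ : Type*}
    [NormedAddCommGroup H₁] [InnerProductSpace ℂ H₁]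
    [NormedAddCommGroup H₂] [InnerProductSpace ℂ H₂]
    [NormedAddCommGroup H₃] [InnerProductSpace ℂ H₃]
    (T : H₁ →ₗ.[ℂ] H₂) (S : H₂ →ₗ.[ℂ] H₃) : H₁ →ₗ.[ℂ] H₃ where
  domain := (Submodule.comap T.toFun S.domain).map T.domain.subtype
  toFun := (S.toFun.comp (T.toFun.restrict (p := Submodule.comap T.toFun S.domain)
      (q := S.domain) fun _ hx => hx)).comp
    (Submodule.equivMapOfInjective T.domain.subtype T.domain.injective_subtype
      (Submodule.comap T.toFun S.domain)).symm.toLinearMap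

section PartialMaps

variable {H₁ H₂ H₃ : Type*} [NormedAddCommGroup H₁] [InnerProductSpace ℂ H₁]
  [NormedAddCommGroup H₂] [InnerProductSpace ℂ H₂]
  [NormedAddCommGroup H₃] [InnerProductSpace ℂ H₃]

theorem mem_pmKer {T : H₁ →ₗ.[ℂ] H₂} {x : H₁} :
    x ∈ pmKer T ↔ ∃ h : x ∈ T.domain, T ⟨x, h⟩ = 0 := by
  simp only [pmKer, Submodule.mem_map, LinearMap.mem_ker]
  constructor
  · rintro ⟨u, hu, rfl⟩
    exact ⟨u.2, hu⟩
  · rintro ⟨h, hx⟩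
    exact ⟨⟨x, h⟩, hx, rfl⟩

theorem mem_pmRan {T : H₁ →ₗ.[ℂ] H₂} {y : H₂} : y ∈ pmRan T ↔ ∃ u : T.domain, T u = y :=
  Iff.rfl

theorem mem_compPM_domain {T : H₁ →ₗ.[ℂ] H₂} {S : H₂ →ₗ.[ℂ] H₃} {x : H₁} :
    x ∈ (compPM T S).domain ↔ ∃ h : x ∈ T.domain, T ⟨x, h⟩ ∈ S.domain := by
  simp only [compPM, Submodule.mem_map, Submodule.mem_comap]
  constructor
  · rintro ⟨u, hu, rfl⟩
    exact ⟨u.2, hu⟩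
  · rintro ⟨h, hx⟩
    exact ⟨⟨x, h⟩, hx, rfl⟩

theorem compPM_apply {T : H₁ →ₗ.[ℂ] H₂} {S : H₂ →ₗ.[ℂ] H₃} {x : H₁}
    (hx : x ∈ (compPM T S).domain) (h : x ∈ T.domain) (h' : T ⟨x, h⟩ ∈ S.domain) :
    compPM T S ⟨x, hx⟩ = S ⟨T ⟨x, h⟩, h'⟩ := by
  have key : (Submodule.equivMapOfInjective T.domain.subtype T.domain.injective_subtype
      (Submodule.comap T.toFun S.domain)).symm ⟨x, hx⟩ = ⟨⟨x, h⟩, h'⟩ := by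
    rw [LinearEquiv.symm_apply_eq]
    rfl
  change S.toFun ((T.toFun.restrict (p := Submodule.comap T.toFun S.domain)
      (q := S.domain) fun _ hx => hx) ((Submodule.equivMapOfInjective T.domain.subtype
        T.domain.injective_subtype (Submodule.comap T.toFun S.domain)).symm ⟨x, hx⟩)) = _
  rw [key]
  rfl

/-- `D` and `S` are mutually adjoint bounded generalized inverses of the formally adjoint
operators `T` and `T'`, with associated symmetric projections `P = DT = T'S` and
`Q = TD = ST'`. -/
structure IsAdjointInversePair (T : H₁ →ₗ.[ℂ] H₂) (T' : H₂ →ₗ.[ℂ] H₁) (D : H₂ →L[ℂ] H₁)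
    (S : H₁ →L[ℂ] H₂) (P : H₁ →L[ℂ] H₁) (Q : H₂ →L[ℂ] H₂) : Prop where
  formal : T.IsFormalAdjoint T'
  inner_left : ∀ x y, inner ℂ (S x) y = inner ℂ x (D y)
  symm_left : ∀ x y, inner ℂ (P x) y = inner ℂ x (P y)
  symm_right : ∀ x y, inner ℂ (Q x) y = inner ℂ x (Q y)
  right_inv : ∀ y, ∃ h : D y ∈ T.domain, T ⟨D y, h⟩ = Q y
  right_inv' : ∀ x, ∃ h : S x ∈ T'.domain, T' ⟨S x, h⟩ = P x
  left_inv : ∀ u : T.domain, D (T u) = P u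
  left_inv' : ∀ z : T'.domain, S (T' z) = Q z
  proj_apply : ∀ u : T.domain, Q (T u) = T u
  proj_apply' : ∀ z : T'.domain, P (T' z) = T' z
  apply_proj : ∀ y, D (Q y) = D y
  apply_proj' : ∀ x, S (P x) = S x

namespace IsAdjointInversePair

variable {T : H₁ →ₗ.[ℂ] H₂} {T' : H₂ →ₗ.[ℂ] H₁} {D : H₂ →L[ℂ] H₁} {S : H₁ →L[ℂ] H₂}
  {P : H₁ →L[ℂ] H₁} {Q : H₂ →L[ℂ] H₂}

protected theorem symm (h : IsAdjointInversePair T T' D S P Q) :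
    IsAdjointInversePair T' T S D Q P where
  formal := h.formal.symm
  inner_left x y := by rw [← inner_conj_symm, ← h.inner_left, inner_conj_symm]
  symm_left := h.symm_right
  symm_right := h.symm_left
  right_inv := h.right_inv'
  right_inv' := h.right_inv
  left_inv := h.left_inv'
  left_inv' := h.left_inv
  proj_apply := h.proj_apply'
  proj_apply' := h.proj_apply
  apply_proj := h.apply_proj'
  apply_proj' := h.apply_proj

theorem proj_inv (h : IsAdjointInversePair T T' D S P Q) (y : H₂) : P (D y) = D y := by
  obtain ⟨hd, hy⟩ := h.right_inv y
  rw [← h.left_inv ⟨D y, hd⟩, hy, h.apply_proj]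

theorem proj_inv' (h : IsAdjointInversePair T T' D S P Q) (x : H₁) : Q (S x) = S x :=
  h.symm.proj_inv x

theorem exists_compPM_inv_apply (h : IsAdjointInversePair T T' D S P Q) (x : H₁) :
    ∃ hx : D (S x) ∈ (compPM T T').domain, compPM T T' ⟨D (S x), hx⟩ = P x := by
  obtain ⟨h₁, e₁⟩ := h.right_inv (S x)
  rw [h.proj_inv'] at e₁
  obtain ⟨h₂, e₂⟩ := h.right_inv' x
  have h₃ : T ⟨D (S x), h₁⟩ ∈ T'.domain := by rwa [e₁]
  refine ⟨mem_compPM_domain.2 ⟨h₁, h₃⟩, ?_⟩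
  rw [compPM_apply _ h₁ h₃, ← e₂]
  congr 2

theorem mem_pmRan_compPM_iff (h : IsAdjointInversePair T T' D S P Q) {x : H₁} :
    x ∈ pmRan (compPM T T') ↔ P x = x := by
  constructor
  · rintro ⟨⟨u, hu⟩, rfl⟩
    obtain ⟨h₁, h₂⟩ := mem_compPM_domain.1 hu
    change P (compPM T T' ⟨u, hu⟩) = compPM T T' ⟨u, hu⟩
    rw [compPM_apply hu h₁ h₂, h.proj_apply']
  · intro hx
    obtain ⟨h₁, e⟩ := h.exists_compPM_inv_apply x
    exact mem_pmRan.2 ⟨_, e.trans hx⟩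

theorem isClosed_pmRan_compPM (h : IsAdjointInversePair T T' D S P Q) :
    IsClosed (pmRan (compPM T T') : Set H₁) := by
  have : (pmRan (compPM T T') : Set H₁) = {x | P x = x} :=
    Set.ext fun _ => h.mem_pmRan_compPM_iff
  rw [this]
  exact isClosed_eq P.continuous continuous_id

theorem proj_proj (h : IsAdjointInversePair T T' D S P Q) (x : H₁) : P (P x) = P x := by
  obtain ⟨h₁, e⟩ := h.right_inv' x
  rw [← e, h.proj_apply']

theorem mem_pmRan_compPM_orthogonal_iff (h : IsAdjointInversePair T T' D S P Q) {x : H₁} :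
    x ∈ (pmRan (compPM T T'))ᗮ ↔ P x = 0 := by
  rw [Submodule.mem_orthogonal]
  constructor
  · intro hx
    have := hx (P x) (h.mem_pmRan_compPM_iff.2 (h.proj_proj x))
    rwa [← h.proj_proj, h.symm_left, inner_self_eq_zero] at this
  · intro hx u hu
    rw [← h.mem_pmRan_compPM_iff.1 hu, h.symm_left, hx, inner_zero_right]

theorem isMPOf_compPM (h : IsAdjointInversePair T T' D S P Q) :
    IsMPOf (compPM T T') (D ∘L S) where
  mem_dom x := (h.exists_compPM_inv_apply x).1
  mem_carrier x := by
    rw [Submodule.mem_orthogonal]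
    intro n hn
    obtain ⟨hd, hn⟩ := mem_pmKer.1 hn
    obtain ⟨h₁, h₂⟩ := mem_compPM_domain.1 hd
    rw [compPM_apply hd h₁ h₂] at hn
    have hT : T ⟨n, h₁⟩ = 0 := by
      have := h.formal ⟨n, h₁⟩ ⟨_, h₂⟩
      rwa [hn, inner_zero_right, inner_self_eq_zero] at this
    have hP : P n = 0 := by rw [← h.left_inv ⟨n, h₁⟩, hT, map_zero]
    rw [ContinuousLinearMap.comp_apply, ← h.proj_inv, ← h.symm_left, hP, inner_zero_left]
  proj_ran x := by
    obtain ⟨_, e⟩ := h.exists_compPM_inv_apply x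
    rw [h.mem_pmRan_compPM_orthogonal_iff]
    change P (x - compPM T T' ⟨D (S x), _⟩) = 0
    rw [e, map_sub, h.proj_proj, sub_self]
  proj_ker := by
    rintro ⟨u, hu⟩
    obtain ⟨h₁, h₂⟩ := mem_compPM_domain.1 hu
    have e : (D ∘L S) (compPM T T' ⟨u, hu⟩) = D (T ⟨u, h₁⟩) := by
      rw [compPM_apply hu h₁ h₂, ContinuousLinearMap.comp_apply, h.left_inv', h.apply_proj]
    obtain ⟨h₃, e₃⟩ := h.right_inv (T ⟨u, h₁⟩)
    have h₄ : T ⟨u - D (T ⟨u, h₁⟩), sub_mem h₁ h₃⟩ = 0 := by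
      have := T.map_sub ⟨u, h₁⟩ ⟨_, h₃⟩
      rw [e₃, h.proj_apply, sub_self] at this
      exact this
    have h₅ : T ⟨u - D (T ⟨u, h₁⟩), sub_mem h₁ h₃⟩ ∈ T'.domain := h₄ ▸ zero_mem _
    rw [e]
    refine mem_pmKer.2 ⟨mem_compPM_domain.2 ⟨_, h₅⟩, ?_⟩
    rw [compPM_apply _ _ h₅, ← T'.map_zero]
    congr 2
  ker_eq x := by
    rw [h.mem_pmRan_compPM_orthogonal_iff]
    constructor
    · intro hx
      obtain ⟨h₁, e⟩ := h.exists_compPM_inv_apply x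
      rw [← e, ← (compPM T T').map_zero]
      congr 2
    · intro hx
      rw [ContinuousLinearMap.comp_apply, ← h.apply_proj', hx, map_zero, map_zero]

end IsAdjointInversePair

/-- A Moore–Penrose inverse and its adjoint are generalized inverses of a densely defined operator
and its adjoint. -/
theorem IsMPOf.isAdjointInversePair [CompleteSpace H₁] [CompleteSpace H₂]
    {T : H₁ →ₗ.[ℂ] H₂} (hTdense : Dense (T.domain : Set H₁)) {Td : H₂ →L[ℂ] H₁}
    (hMP : IsMPOf T Td) :
    IsAdjointInversePair T T.adjoint Td Td.adjoint
      (pmKer T)ᗮ.starProjection (pmRan T)ᗮᗮ.starProjection := by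
  set P := (pmKer T)ᗮ.starProjection
  set Q := (pmRan T)ᗮᗮ.starProjection
  have formal : T.adjoint.IsFormalAdjoint T := LinearPMap.adjoint_isFormalAdjoint hTdense
  have symm_left : ∀ x y, inner ℂ (P x) y = inner ℂ x (P y) :=
    Submodule.inner_starProjection_left_eq_right _
  have symm_right : ∀ x y, inner ℂ (Q x) y = inner ℂ x (Q y) :=
    Submodule.inner_starProjection_left_eq_right _
  have left_inv : ∀ u : T.domain, Td (T u) = P u := fun u =>
    (Submodule.eq_starProjection_of_mem_of_inner_eq_zero (hMP.mem_carrier _) fun w hw =>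
      (Submodule.mem_orthogonal _ _).1 hw _ (hMP.proj_ker u)).symm
  have ran_le : pmRan T ≤ (pmRan T)ᗮᗮ := Submodule.le_orthogonal_orthogonal _
  have right_inv : ∀ y, T ⟨Td y, hMP.mem_dom y⟩ = Q y := fun y =>
    (Submodule.eq_starProjection_of_mem_of_inner_eq_zero
      (ran_le (mem_pmRan.2 ⟨_, rfl⟩)) fun w hw =>
      (Submodule.mem_orthogonal _ _).1 hw _ (hMP.proj_ran y)).symm
  have proj_inv : ∀ y, P (Td y) = Td y := fun y =>
    Submodule.starProjection_eq_self_iff.2 (hMP.mem_carrier y)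
  have right_inv' : ∀ x, ∃ h : Td.adjoint x ∈ T.adjoint.domain,
      T.adjoint ⟨Td.adjoint x, h⟩ = P x := by
    intro x
    have key : ∀ u : T.domain, inner ℂ (P x) (u : H₁) = inner ℂ (Td.adjoint x) (T u) := fun u => by
      rw [symm_left, ContinuousLinearMap.adjoint_inner_left, left_inv]
    exact ⟨LinearPMap.mem_adjoint_domain_of_exists _ ⟨_, key⟩,
      LinearPMap.adjoint_apply_eq hTdense _ key⟩
  refine
    { formal := formal.symm
      inner_left := fun x y => ContinuousLinearMap.adjoint_inner_left _ _ _
      symm_left := symm_left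
      symm_right := symm_right
      right_inv := fun y => ⟨hMP.mem_dom y, right_inv y⟩
      right_inv' := right_inv'
      left_inv := left_inv
      left_inv' := fun z => ext_inner_right ℂ fun y => ?_
      proj_apply := fun u => Submodule.starProjection_eq_self_iff.2 (ran_le (mem_pmRan.2 ⟨u, rfl⟩))
      proj_apply' := fun z => Submodule.starProjection_eq_self_iff.2 ?_
      apply_proj := fun y => ?_
      apply_proj' := fun x => ext_inner_right ℂ fun y => ?_ }
  · rw [ContinuousLinearMap.adjoint_inner_left, symm_right, ← right_inv]
    exact formal z ⟨Td y, _⟩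
  · rw [Submodule.mem_orthogonal']
    intro n hn
    obtain ⟨hd, hn⟩ := mem_pmKer.1 hn
    rw [formal z ⟨n, hd⟩, hn, inner_zero_right]
  · rw [← right_inv, left_inv, proj_inv]
  · rw [ContinuousLinearMap.adjoint_inner_left, ContinuousLinearMap.adjoint_inner_left, symm_left,
      proj_inv]

end PartialMaps

/-- Theorem 4.1: for a densely defined closed operator `T` with closed range, the
operators `T*T` and `TT*` have closed range, their Moore–Penrose inverses are bounded,
and `(T*T)† T* ⊆ T* (TT*)† = T†`: namely `T*((TT*)† y) = T† y` for all `y ∈ H₂` and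
`(T*T)†(T* z) = T† z` for all `z ∈ D(T*)`. -/
theorem stmt11 {H₁ H₂ : Type*} [NormedAddCommGroup H₁] [InnerProductSpace ℂ H₁] [CompleteSpace H₁]
    [NormedAddCommGroup H₂] [InnerProductSpace ℂ H₂] [CompleteSpace H₂]
    (T : H₁ →ₗ.[ℂ] H₂) (hTclosed : T.IsClosed) (hTdense : Dense (T.domain : Set H₁))
    (hTran : IsClosed (pmRan T : Set H₂))
    (Td : H₂ →L[ℂ] H₁) (hMP : IsMPOf T Td) :
    IsClosed (pmRan (compPM T T.adjoint) : Set H₁) ∧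
      IsClosed (pmRan (compPM T.adjoint T) : Set H₂) ∧
      ∃ A : H₁ →L[ℂ] H₁, IsMPOf (compPM T T.adjoint) A ∧
        ∃ B : H₂ →L[ℂ] H₂, IsMPOf (compPM T.adjoint T) B ∧
          (∀ y : H₂, ∃ h : B y ∈ T.adjoint.domain, T.adjoint ⟨B y, h⟩ = Td y) ∧
          (∀ z : T.adjoint.domain, A (T.adjoint z) = Td (z : H₂)) := by
  have h := hMP.isAdjointInversePair hTdense
  refine ⟨h.isClosed_pmRan_compPM, h.symm.isClosed_pmRan_compPM, _, h.isMPOf_compPM, _,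
    h.symm.isMPOf_compPM, fun y => ?_, fun z => ?_⟩
  · obtain ⟨hd, e⟩ := h.right_inv' (Td y)
    exact ⟨hd, e.trans (h.proj_inv y)⟩
  · rw [ContinuousLinearMap.comp_apply, h.left_inv', h.apply_proj]
end
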